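/- arXiv:1910.08882 — 2 statements merged into one kernel-verified Lean document; each statement's English description precedes it below -/
import Mathlib

section
/- Let {p_k}_{k≥0} be the monic Hermite polynomials, i.e. p_k is monic of degree k and ∫_ℝ p_j(x) p_k(x) e^{−x²} dx = 0 for j ≠ k. Then for all integers m, n ≥ 0, (1/2) ∫_ℝ (p_{2m}(z) p_{2n+1}'(z) − p_{2m}'(z) p_{2n+1}(z)) e^{−z²} dz = 2^{−2n−1} √π Γ(2n+2) δ_{n,m} − 2^{−2m} √π Γ(2m+1) δ_{m−1,n}. -/
open MeasureTheory Polynomial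

/-- A polynomial times the Gaussian weight `e^{-x²}` is integrable. -/
lemma integrable_eval_mul_exp_neg_sq (q : ℝ[X]) :
    Integrable fun x : ℝ => q.eval x * Real.exp (-x ^ 2) := by
  induction q using Polynomial.induction_on' with
  | add p q hp hq =>
    simp only [eval_add, add_mul]
    exact hp.add hq
  | monomial n a =>
    have h := (integrable_rpow_mul_exp_neg_mul_sq (b := 1) one_pos (s := n)
      (by linarith [n.cast_nonneg (α := ℝ)])).const_mul a
    simpa [mul_assoc] using h

/-- Integration of polynomials against the Gaussian weight `e^{-x²}`. -/
noncomputable def gaussianFunctional : ℝ[X] →ₗ[ℝ] ℝ where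
  toFun q := ∫ x : ℝ, q.eval x * Real.exp (-x ^ 2)
  map_add' p q := by
    simp only [eval_add, add_mul]
    exact integral_add (integrable_eval_mul_exp_neg_sq p) (integrable_eval_mul_exp_neg_sq q)
  map_smul' c q := by
    simp only [eval_smul, smul_eq_mul, mul_assoc, integral_const_mul, RingHom.id_apply]

lemma gaussianFunctional_apply (q : ℝ[X]) :
    gaussianFunctional q = ∫ x : ℝ, q.eval x * Real.exp (-x ^ 2) := rfl

lemma gaussianFunctional_one : gaussianFunctional 1 = √Real.pi := by
  simpa [gaussianFunctional_apply] using integral_gaussian 1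

/-- Integration by parts for the Gaussian weight. -/
lemma gaussianFunctional_derivative (q : ℝ[X]) :
    gaussianFunctional (derivative q) = 2 * gaussianFunctional (X * q) := by
  have hd : ∀ x : ℝ, HasDerivAt (fun x : ℝ => q.eval x * Real.exp (-x ^ 2))
      ((derivative q - C 2 * (X * q)).eval x * Real.exp (-x ^ 2)) x := by
    intro x
    have h := (q.hasDerivAt x).mul (((hasDerivAt_id x).pow 2).neg.exp)
    refine h.congr_deriv ?_
    simp
    ring
  have h0 : gaussianFunctional (derivative q - C 2 * (X * q)) = 0 :=
    integral_eq_zero_of_hasDerivAt_of_integrable hd (integrable_eval_mul_exp_neg_sq _)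
      (integrable_eval_mul_exp_neg_sq q)
  rw [← smul_eq_C_mul, map_sub, map_smul, smul_eq_mul] at h0
  linarith

lemma degree_sub_C_coeff_mul_lt {q r : ℝ[X]} {d : ℕ} (hr : r.Monic) (hrd : r.natDegree = d)
    (hq : q.degree < (d + 1 : ℕ)) : (q - C (q.coeff d) * r).degree < d := by
  rw [degree_lt_iff_coeff_zero] at hq ⊢
  intro m hm
  rw [coeff_sub, coeff_C_mul]
  rcases hm.eq_or_lt with rfl | hlt
  · have h : r.coeff d = 1 := by rw [← hrd]; exact hr
    simp [h]
  · rw [hq m hlt, coeff_eq_zero_of_natDegree_lt (hrd.trans_lt hlt)]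
    simp

lemma gaussianFunctional_mul_eq_zero_of_degree_lt {P : ℕ → ℝ[X]} (hmonic : ∀ k, (P k).Monic)
    (hdeg : ∀ k, (P k).natDegree = k)
    (horth : ∀ j k, j ≠ k → gaussianFunctional (P j * P k) = 0)
    {q : ℝ[X]} {k : ℕ} (hq : q.degree < k) :
    gaussianFunctional (q * P k) = 0 := by
  suffices H : ∀ d ≤ k, ∀ q : ℝ[X], q.degree < d → gaussianFunctional (q * P k) = 0 from
    H k le_rfl q hq
  intro d
  induction d with
  | zero =>
    intro _ q hq
    have : q = 0 := by simpa using hq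
    simp [this]
  | succ d ih =>
    intro hd q hq
    have h := ih (by omega) _ (degree_sub_C_coeff_mul_lt (hmonic d) (hdeg d) hq)
    rwa [sub_mul, mul_assoc, ← smul_eq_C_mul, map_sub, map_smul, horth d k (by omega),
      smul_zero, sub_zero] at h

lemma gaussianFunctional_mul_eq_coeff_mul {P : ℕ → ℝ[X]} (hmonic : ∀ k, (P k).Monic)
    (hdeg : ∀ k, (P k).natDegree = k)
    (horth : ∀ j k, j ≠ k → gaussianFunctional (P j * P k) = 0)
    {q : ℝ[X]} {k : ℕ} (hq : q.degree < (k + 1 : ℕ)) :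
    gaussianFunctional (q * P k) = q.coeff k * gaussianFunctional (P k * P k) := by
  have h := gaussianFunctional_mul_eq_zero_of_degree_lt hmonic hdeg horth
    (degree_sub_C_coeff_mul_lt (hmonic k) (hdeg k) hq)
  rw [sub_mul, mul_assoc, ← smul_eq_C_mul, map_sub, map_smul, smul_eq_mul] at h
  linarith

lemma gaussianFunctional_derivative_succ_mul {P : ℕ → ℝ[X]} (hmonic : ∀ k, (P k).Monic)
    (hdeg : ∀ k, (P k).natDegree = k)
    (horth : ∀ j k, j ≠ k → gaussianFunctional (P j * P k) = 0)
    (k : ℕ) :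
    gaussianFunctional (derivative (P (k + 1)) * P k)
      = (k + 1) * gaussianFunctional (P k * P k) := by
  rw [gaussianFunctional_mul_eq_coeff_mul hmonic hdeg horth]
  · have h : (P (k + 1)).coeff (k + 1) = 1 := by
      have := hmonic (k + 1)
      rwa [Monic, leadingCoeff, hdeg] at this
    rw [coeff_derivative, h, one_mul]
  · refine (degree_derivative_lt (hmonic _).ne_zero).trans_le ?_
    rw [degree_eq_natDegree (hmonic _).ne_zero, hdeg]

lemma gaussianFunctional_derivative_mul_eq_sub (P : ℕ → ℝ[X]) (j k : ℕ) :
    gaussianFunctional (derivative (P j) * P k)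
      = 2 * gaussianFunctional (X * P k * P j) - gaussianFunctional (derivative (P k) * P j) := by
  have h := gaussianFunctional_derivative (P j * P k)
  rw [derivative_mul, map_add, mul_comm (P j) (derivative (P k)), mul_comm (P j) (P k),
    ← mul_assoc] at h
  linarith

lemma gaussianFunctional_derivative_mul_of_lt {P : ℕ → ℝ[X]} (hmonic : ∀ k, (P k).Monic)
    (hdeg : ∀ k, (P k).natDegree = k)
    (horth : ∀ j k, j ≠ k → gaussianFunctional (P j * P k) = 0)
    {j k : ℕ} (hjk : j < k + 1) :
    gaussianFunctional (derivative (P j) * P k) = 0 := by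
  refine gaussianFunctional_mul_eq_zero_of_degree_lt hmonic hdeg horth
    ((degree_derivative_lt (hmonic _).ne_zero).trans_le ?_)
  rw [degree_eq_natDegree (hmonic _).ne_zero, hdeg]
  exact_mod_cast Nat.lt_succ_iff.mp hjk

lemma degree_X_mul_self {P : ℕ → ℝ[X]} (hmonic : ∀ k, (P k).Monic)
    (hdeg : ∀ k, (P k).natDegree = k) (k : ℕ) : (X * P k).degree = ((k + 1 : ℕ) : WithBot ℕ) := by
  rw [degree_eq_natDegree (monic_X.mul (hmonic k)).ne_zero,
    monic_X.natDegree_mul (hmonic k), hdeg, natDegree_X, add_comm]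

lemma gaussianFunctional_derivative_mul_of_gt {P : ℕ → ℝ[X]} (hmonic : ∀ k, (P k).Monic)
    (hdeg : ∀ k, (P k).natDegree = k)
    (horth : ∀ j k, j ≠ k → gaussianFunctional (P j * P k) = 0)
    {j k : ℕ} (hjk : k + 1 < j) :
    gaussianFunctional (derivative (P j) * P k) = 0 := by
  rw [gaussianFunctional_derivative_mul_eq_sub P,
    gaussianFunctional_derivative_mul_of_lt hmonic hdeg horth (by omega),
    gaussianFunctional_mul_eq_zero_of_degree_lt hmonic hdeg horth]
  · simp
  · rw [degree_X_mul_self hmonic hdeg]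
    exact_mod_cast hjk

lemma gaussianFunctional_succ_mul_self {P : ℕ → ℝ[X]} (hmonic : ∀ k, (P k).Monic)
    (hdeg : ∀ k, (P k).natDegree = k)
    (horth : ∀ j k, j ≠ k → gaussianFunctional (P j * P k) = 0)
    (k : ℕ) :
    gaussianFunctional (P (k + 1) * P (k + 1)) = (k + 1) / 2 * gaussianFunctional (P k * P k) := by
  have h := gaussianFunctional_derivative_mul_eq_sub P (k + 1) k
  rw [gaussianFunctional_derivative_succ_mul hmonic hdeg horth,
    gaussianFunctional_derivative_mul_of_lt hmonic hdeg horth (by omega),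
    gaussianFunctional_mul_eq_coeff_mul hmonic hdeg horth (q := X * P k), coeff_X_mul] at h
  · have h1 : (P k).coeff k = 1 := by
      have := hmonic k
      rwa [Monic, leadingCoeff, hdeg] at this
    rw [h1] at h
    linarith
  · rw [degree_X_mul_self hmonic hdeg]
    exact_mod_cast Nat.lt_succ_self _

/-- The squared norms of the monic Hermite polynomials. -/
lemma gaussianFunctional_mul_self {P : ℕ → ℝ[X]} (hmonic : ∀ k, (P k).Monic)
    (hdeg : ∀ k, (P k).natDegree = k)
    (horth : ∀ j k, j ≠ k → gaussianFunctional (P j * P k) = 0)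
    (k : ℕ) :
    gaussianFunctional (P k * P k) = k.factorial * √Real.pi / 2 ^ k := by
  induction k with
  | zero =>
    have h : P 0 = 1 := (hmonic 0).natDegree_eq_zero.mp (hdeg 0)
    simp [h, gaussianFunctional_one]
  | succ k ih =>
    rw [gaussianFunctional_succ_mul_self hmonic hdeg horth, ih, Nat.factorial_succ]
    push_cast
    rw [pow_succ']
    field_simp

lemma gaussianFunctional_derivative_mul {P : ℕ → ℝ[X]} (hmonic : ∀ k, (P k).Monic)
    (hdeg : ∀ k, (P k).natDegree = k)
    (horth : ∀ j k, j ≠ k → gaussianFunctional (P j * P k) = 0)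
    (j k : ℕ) :
    gaussianFunctional (derivative (P j) * P k)
      = if j = k + 1 then (k + 1).factorial * √Real.pi / 2 ^ k else 0 := by
  split_ifs with h
  · rw [h, gaussianFunctional_derivative_succ_mul hmonic hdeg horth,
      gaussianFunctional_mul_self hmonic hdeg horth, Nat.factorial_succ]
    push_cast
    ring
  · rcases lt_or_gt_of_ne h with h | h
    · exact gaussianFunctional_derivative_mul_of_lt hmonic hdeg horth h
    · exact gaussianFunctional_derivative_mul_of_gt hmonic hdeg horth h

/-- **Gaussian case, β = 4 pairing**: for the monic Hermite polynomials `p_k`,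
`⟨p_{2m}, p_{2n+1}⟩_4 = 2^{-2n-1} √π Γ(2n+2) δ_{n,m} - 2^{-2m} √π Γ(2m+1) δ_{m-1,n}`,
where the β = 4 skew inner product has weight `e^{-z²}` on `ℝ`. -/
theorem statement6
    (p : ℤ → Polynomial ℝ) (hpneg : p (-1) = 0)
    (hmonic : ∀ k : ℕ, (p k).Monic) (hdeg : ∀ k : ℕ, (p k).natDegree = k)
    (horth : ∀ j k : ℕ, j ≠ k →
      ∫ x : ℝ, (p j).eval x * (p k).eval x * Real.exp (-x ^ 2) = 0) :
    ∀ m n : ℕ,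
      (1 / 2 : ℝ) * ∫ z : ℝ,
          ((p (2 * m)).eval z * (Polynomial.derivative (p (2 * n + 1))).eval z
            - (Polynomial.derivative (p (2 * m))).eval z * (p (2 * n + 1)).eval z)
          * Real.exp (-z ^ 2)
        = (if n = m then
            (2 : ℝ) ^ (-(2 * (n : ℤ)) - 1) * Real.sqrt Real.pi * Real.Gamma (2 * n + 2)
          else 0)
          - (if (m : ℤ) - 1 = (n : ℤ) then
            (2 : ℝ) ^ (-(2 * (m : ℤ))) * Real.sqrt Real.pi * Real.Gamma (2 * m + 1)
          else 0) := by
  intro m n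
  have hL : ∀ j k : ℕ, j ≠ k → gaussianFunctional (p j * p k) = 0 := fun j k hjk => by
    simpa only [gaussianFunctional_apply, eval_mul] using horth j k hjk
  have key := gaussianFunctional_derivative_mul (P := fun k : ℕ => p k) hmonic hdeg hL
  have h1 := key (2 * n + 1) (2 * m)
  have h2 := key (2 * m) (2 * n + 1)
  push_cast at h1 h2
  have hint : (∫ z : ℝ, ((p (2 * m)).eval z * (derivative (p (2 * n + 1))).eval z
      - (derivative (p (2 * m))).eval z * (p (2 * n + 1)).eval z) * Real.exp (-z ^ 2))
      = gaussianFunctional (derivative (p (2 * n + 1)) * p (2 * m))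
        - gaussianFunctional (derivative (p (2 * m)) * p (2 * n + 1)) := by
    rw [← map_sub, gaussianFunctional_apply]
    simp only [eval_sub, eval_mul, mul_comm]
  have hΓ1 : Real.Gamma (2 * n + 2) = (2 * n + 1).factorial := by
    rw [← Real.Gamma_nat_eq_factorial]
    push_cast
    ring_nf
  have hΓ2 : Real.Gamma (2 * m + 1) = (2 * m).factorial := by
    rw [← Real.Gamma_nat_eq_factorial]
    push_cast
    rfl
  have hpow1 : (2 : ℝ) ^ (-(2 * (n : ℤ)) - 1) = 1 / 2 ^ (2 * n + 1) := by
    rw [show -(2 * (n : ℤ)) - 1 = -((2 * n + 1 : ℕ) : ℤ) by push_cast; ring, zpow_neg,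
      zpow_natCast, one_div]
  have hpow2 : (2 : ℝ) ^ (-(2 * (m : ℤ))) = 1 / 2 ^ (2 * m) := by
    rw [show -(2 * (m : ℤ)) = -((2 * m : ℕ) : ℤ) by push_cast; ring, zpow_neg,
      zpow_natCast, one_div]
  rw [hint, h1, h2, hΓ1, hΓ2, hpow1, hpow2, mul_sub]
  congr 1
  · by_cases h : n = m
    · subst h
      simp only [if_true]
      field_simp
      ring
    · rw [if_neg (by omega), if_neg h, mul_zero]
  · by_cases h : m = n + 1
    · subst h
      rw [if_pos (by ring), if_pos (by push_cast; ring), show 2 * (n + 1) = 2 * n + 1 + 1 by ring]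
      field_simp
      ring
    · rw [if_neg (by omega), if_neg (by omega), mul_zero]
end

section
/- Let a > −1 and let {p_n^{(a)}}_{n≥0} be the monic Laguerre polynomials, i.e. p_n^{(a)} is monic of degree n and ∫_0^∞ p_n^{(a)}(z) p_m^{(a)}(z) z^a e^{−z} dz = 0 for n ≠ m. Then for all integers m, n ≥ 0, (1/2) ∫_0^∞ (p_{2m}^{(a)}(z) (p_{2n+1}^{(a)})'(z) − (p_{2m}^{(a)})'(z) p_{2n+1}^{(a)}(z)) z^{a+1} e^{−z} dz = (1/2) Γ(2n+2) Γ(2n+a+2) δ_{n,m} − (1/2) Γ(2m+1) Γ(2m+a+1) δ_{m−1,n}. -/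
open MeasureTheory Polynomial

/-- The linear functional on polynomials with moments `X ^ k ↦ Γ(k + a + 1)`. -/
noncomputable def laguerreFunctional (a : ℝ) : ℝ[X] →ₗ[ℝ] ℝ :=
  Polynomial.lsum fun k => LinearMap.mulRight ℝ (Real.Gamma (k + a + 1))

lemma laguerreFunctional_monomial (a : ℝ) (k : ℕ) (c : ℝ) :
    laguerreFunctional a (monomial k c) = c * Real.Gamma (k + a + 1) := by
  simp [laguerreFunctional, Polynomial.lsum_apply]

lemma integrableOn_and_integral_eq_laguerreFunctional {a : ℝ} (ha : -1 < a) (q : ℝ[X]) :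
    IntegrableOn (fun z : ℝ => q.eval z * z ^ a * Real.exp (-z)) (Set.Ioi 0) ∧
      ∫ z in Set.Ioi (0 : ℝ), q.eval z * z ^ a * Real.exp (-z) = laguerreFunctional a q := by
  induction q using Polynomial.induction_on' with
  | add q r hq hr =>
    have h : (fun z : ℝ => (q + r).eval z * z ^ a * Real.exp (-z)) = fun z =>
        q.eval z * z ^ a * Real.exp (-z) + r.eval z * z ^ a * Real.exp (-z) := by
      ext z; rw [eval_add]; ring
    rw [h, map_add, integral_add hq.1 hr.1, hq.2, hr.2]
    exact ⟨hq.1.add hr.1, rfl⟩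
  | monomial k c =>
    have hk : 0 < (k : ℝ) + a + 1 := by
      have : (0 : ℝ) ≤ k := k.cast_nonneg
      linarith
    have h : Set.EqOn (fun z : ℝ => c * (Real.exp (-z) * z ^ ((k : ℝ) + a + 1 - 1)))
        (fun z => (monomial k c).eval z * z ^ a * Real.exp (-z)) (Set.Ioi 0) := by
      intro z hz
      have hz' : 0 < z := hz
      simp only [eval_monomial, add_sub_cancel_right]
      rw [Real.rpow_add hz', Real.rpow_natCast]
      ring
    refine ⟨IntegrableOn.congr_fun ((Real.GammaIntegral_convergent hk).const_mul c) h
      measurableSet_Ioi, ?_⟩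
    rw [← setIntegral_congr_fun measurableSet_Ioi h, integral_const_mul,
      ← Real.Gamma_eq_integral hk, laguerreFunctional_monomial]

lemma laguerreFunctional_X_mul_derivative {a : ℝ} (ha : -1 < a) (q : ℝ[X]) :
    laguerreFunctional a (X * derivative q) =
      laguerreFunctional a (X * q) - (a + 1) * laguerreFunctional a q := by
  induction q using Polynomial.induction_on' with
  | add q r hq hr => simp only [mul_add, map_add, hq, hr]; ring
  | monomial k c =>
    have hk : (k : ℝ) + a + 1 ≠ 0 := by
      have : (0 : ℝ) ≤ k := k.cast_nonneg
      linarith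
    have h : X * derivative (monomial k c) = monomial k (c * k) := by
      cases k with
      | zero => simp
      | succ k => rw [derivative_monomial, X_mul_monomial]; simp
    have hG : Real.Gamma (((k + 1 : ℕ) : ℝ) + a + 1) =
        ((k : ℝ) + a + 1) * Real.Gamma (k + a + 1) := by
      rw [← Real.Gamma_add_one hk]; push_cast; ring_nf
    rw [h, X_mul_monomial, laguerreFunctional_monomial, laguerreFunctional_monomial,
      laguerreFunctional_monomial, hG]
    ring

section OrthogonalSequence

variable {L : ℝ[X] →ₗ[ℝ] ℝ} {P : ℕ → ℝ[X]}

lemma coeff_eq_one_of_monic_natDegree (hmonic : ∀ n, (P n).Monic)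
    (hdeg : ∀ n, (P n).natDegree = n) (n : ℕ) : (P n).coeff n = 1 := by
  have := hmonic n
  rwa [Monic, leadingCoeff, hdeg] at this

lemma coeff_eq_zero_of_natDegree (hdeg : ∀ n, (P n).natDegree = n) {n k : ℕ} (h : n < k) :
    (P n).coeff k = 0 :=
  coeff_eq_zero_of_natDegree_lt (by rwa [hdeg])

lemma orthogonal_of_coeff_eq_zero (hmonic : ∀ n, (P n).Monic)
    (hdeg : ∀ n, (P n).natDegree = n) (horth : ∀ n m, n ≠ m → L (P n * P m) = 0)
    {n : ℕ} {q : ℝ[X]} (hq : ∀ k, n ≤ k → q.coeff k = 0) : L (P n * q) = 0 := by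
  have key : ∀ d ≤ n, ∀ q : ℝ[X], (∀ k, d ≤ k → q.coeff k = 0) → L (P n * q) = 0 := by
    intro d
    induction d with
    | zero =>
      intro _ q hq
      have : q = 0 := by ext k; simpa using hq k k.zero_le
      simp [this]
    | succ d ih =>
      intro hd q hq
      have h := ih (by omega) (q - q.coeff d • P d) (by
        intro k hk
        rcases hk.eq_or_lt with rfl | hk
        · simp [coeff_eq_one_of_monic_natDegree hmonic hdeg]
        · simp [hq k hk, coeff_eq_zero_of_natDegree hdeg hk])
      rw [mul_sub, mul_smul_comm, map_sub, map_smul, horth n d (by omega)] at h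
      simpa using h
  exact key n le_rfl q hq

lemma pairing_eq_coeff_mul (hmonic : ∀ n, (P n).Monic)
    (hdeg : ∀ n, (P n).natDegree = n) (horth : ∀ n m, n ≠ m → L (P n * P m) = 0)
    {n : ℕ} {q : ℝ[X]} (hq : ∀ k, n < k → q.coeff k = 0) :
    L (P n * q) = q.coeff n * L (P n * P n) := by
  have h := orthogonal_of_coeff_eq_zero hmonic hdeg horth (n := n)
    (q := q - q.coeff n • P n) (by
      intro k hk
      rcases hk.eq_or_lt with rfl | hk
      · simp [coeff_eq_one_of_monic_natDegree hmonic hdeg]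
      · simp [hq k hk, coeff_eq_zero_of_natDegree hdeg hk])
  rw [mul_sub, mul_smul_comm, map_sub, map_smul, smul_eq_mul] at h
  linarith

lemma pairing_eq_coeff_sub_mul (hmonic : ∀ n, (P n).Monic)
    (hdeg : ∀ n, (P n).natDegree = n) (horth : ∀ n m, n ≠ m → L (P n * P m) = 0)
    {n : ℕ} {q : ℝ[X]} (hq : ∀ k, n + 1 < k → q.coeff k = 0) :
    L (P n * q) = (q.coeff n - q.coeff (n + 1) * (P (n + 1)).coeff n) * L (P n * P n) := by
  have h := pairing_eq_coeff_mul hmonic hdeg horth (n := n)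
    (q := q - q.coeff (n + 1) • P (n + 1)) (by
      intro k hk
      rcases (Nat.succ_le_of_lt hk).eq_or_lt with rfl | hk
      · simp [coeff_eq_one_of_monic_natDegree hmonic hdeg]
      · simp [hq k hk, coeff_eq_zero_of_natDegree hdeg hk])
  rw [mul_sub, mul_smul_comm, map_sub, map_smul, horth n (n + 1) (by omega)] at h
  simpa using h

end OrthogonalSequence

lemma coeff_X_mul_derivative (q : ℝ[X]) (k : ℕ) :
    (X * derivative q).coeff k = k * q.coeff k := by
  cases k with
  | zero => simp
  | succ k => rw [coeff_X_mul, coeff_derivative]; push_cast; ring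

section Laguerre

variable {a : ℝ} {P : ℕ → ℝ[X]}

lemma laguerreFunctional_mul_X_mul_derivative_eq_zero (hmonic : ∀ n, (P n).Monic)
    (hdeg : ∀ n, (P n).natDegree = n)
    (horth : ∀ n m, n ≠ m → laguerreFunctional a (P n * P m) = 0) {m n : ℕ} (h : n < m) :
    laguerreFunctional a (P m * (X * derivative (P n))) = 0 :=
  orthogonal_of_coeff_eq_zero hmonic hdeg horth fun k hk => by
    rw [coeff_X_mul_derivative, coeff_eq_zero_of_natDegree hdeg (h.trans_le hk), mul_zero]

lemma laguerreFunctional_mul_X_mul_derivative_of_lt (ha : -1 < a) (hmonic : ∀ n, (P n).Monic)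
    (hdeg : ∀ n, (P n).natDegree = n)
    (horth : ∀ n m, n ≠ m → laguerreFunctional a (P n * P m) = 0) {m n : ℕ} (h : m < n) :
    laguerreFunctional a (P m * (X * derivative (P n))) =
      if m + 1 = n then laguerreFunctional a (P n * P n) else 0 := by
  have h1 := laguerreFunctional_X_mul_derivative ha (P m * P n)
  have h2 : X * derivative (P m * P n) =
      P n * (X * derivative (P m)) + P m * (X * derivative (P n)) := by
    rw [derivative_mul]; ring
  have h3 : X * (P m * P n) = P n * (X * P m) := by ring
  have hc : ∀ k, n < k → (X * P m).coeff k = 0 := by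
    intro k hk
    obtain ⟨k, rfl⟩ := Nat.exists_eq_add_of_lt hk
    rw [coeff_X_mul]
    exact coeff_eq_zero_of_natDegree hdeg (by omega)
  rw [h2, map_add, laguerreFunctional_mul_X_mul_derivative_eq_zero hmonic hdeg horth h,
    h3, horth m n h.ne, pairing_eq_coeff_mul hmonic hdeg horth hc] at h1
  rw [zero_add, mul_zero, sub_zero] at h1
  rw [h1]
  obtain ⟨n, rfl⟩ : ∃ l, n = l + 1 := ⟨n - 1, by omega⟩
  rw [coeff_X_mul]
  split_ifs with hmn
  · obtain rfl : m = n := by omega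
    rw [coeff_eq_one_of_monic_natDegree hmonic hdeg, one_mul]
  · rw [coeff_eq_zero_of_natDegree hdeg (by omega), zero_mul]

lemma laguerreFunctional_X_mul_sq (ha : -1 < a) (hmonic : ∀ n, (P n).Monic)
    (hdeg : ∀ n, (P n).natDegree = n)
    (horth : ∀ n m, n ≠ m → laguerreFunctional a (P n * P m) = 0) (n : ℕ) :
    laguerreFunctional a (P n * (X * P n)) =
      (2 * n + a + 1) * laguerreFunctional a (P n * P n) := by
  have h1 := laguerreFunctional_X_mul_derivative ha (P n * P n)
  have h2 : X * derivative (P n * P n) =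
      P n * (X * derivative (P n)) + P n * (X * derivative (P n)) := by
    rw [derivative_mul]; ring
  have h3 : X * (P n * P n) = P n * (X * P n) := by ring
  have h4 := pairing_eq_coeff_mul hmonic hdeg horth (n := n) (q := X * derivative (P n))
    fun k hk => by rw [coeff_X_mul_derivative, coeff_eq_zero_of_natDegree hdeg hk, mul_zero]
  rw [coeff_X_mul_derivative, coeff_eq_one_of_monic_natDegree hmonic hdeg] at h4
  rw [h2, h3, map_add, h4] at h1
  linarith

lemma laguerre_norm_and_coeff (ha : -1 < a) (hmonic : ∀ n, (P n).Monic)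
    (hdeg : ∀ n, (P n).natDegree = n)
    (horth : ∀ n m, n ≠ m → laguerreFunctional a (P n * P m) = 0) (n : ℕ) :
    laguerreFunctional a (P n * P n) = Real.Gamma (n + 1) * Real.Gamma (n + a + 1) ∧
      (X * P n).coeff n = -(n * (n + a)) := by
  induction n with
  | zero =>
    have h0 : P 0 = 1 := (hmonic 0).natDegree_eq_zero.mp (hdeg 0)
    have h1 : (1 : ℝ[X]) = monomial 0 1 := rfl
    refine ⟨?_, by simp⟩
    rw [h0, mul_one, h1, laguerreFunctional_monomial]
    simp
  | succ n ih =>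
    obtain ⟨hnorm, hcoeff⟩ := ih
    have hn : (0 : ℝ) ≤ n := n.cast_nonneg
    have hpos : laguerreFunctional a (P n * P n) ≠ 0 := by
      rw [hnorm]
      exact (mul_pos (Real.Gamma_pos_of_pos (by linarith))
        (Real.Gamma_pos_of_pos (by linarith))).ne'
    have hX := pairing_eq_coeff_sub_mul hmonic hdeg horth (n := n) (q := X * P n) (by
      intro k hk
      obtain ⟨k, rfl⟩ := Nat.exists_eq_add_of_lt hk
      rw [coeff_X_mul]
      exact coeff_eq_zero_of_natDegree hdeg (by omega))
    rw [laguerreFunctional_X_mul_sq ha hmonic hdeg horth, coeff_X_mul,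
      coeff_eq_one_of_monic_natDegree hmonic hdeg, hcoeff] at hX
    have hd : (P (n + 1)).coeff n = -((n + 1) * (n + 1 + a)) := by
      have := mul_right_cancel₀ hpos hX
      linarith
    have hD := pairing_eq_coeff_sub_mul hmonic hdeg horth (n := n)
      (q := X * derivative (P (n + 1))) fun k hk => by
        rw [coeff_X_mul_derivative, coeff_eq_zero_of_natDegree hdeg hk, mul_zero]
    rw [laguerreFunctional_mul_X_mul_derivative_of_lt ha hmonic hdeg horth n.lt_succ_self,
      if_pos rfl, coeff_X_mul_derivative, coeff_X_mul_derivative,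
      coeff_eq_one_of_monic_natDegree hmonic hdeg, hd, hnorm] at hD
    refine ⟨?_, by rw [coeff_X_mul, hd]; push_cast; ring⟩
    have hG : Real.Gamma ((n : ℝ) + 1 + a + 1) = (n + a + 1) * Real.Gamma (n + a + 1) := by
      rw [← Real.Gamma_add_one (by linarith)]; ring_nf
    rw [hD]
    push_cast
    rw [hG, Real.Gamma_add_one (s := (n : ℝ) + 1) (by linarith)]
    ring

end Laguerre

/-- **Laguerre case, β = 4 pairing**: for the monic Laguerre polynomials `p_n^{(a)}`,
`⟨p_{2m}^{(a)}, p_{2n+1}^{(a)}⟩_4 = (1/2) Γ(2n+2) Γ(2n+a+2) δ_{n,m}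
 - (1/2) Γ(2m+1) Γ(2m+a+1) δ_{m-1,n}`,
where the β = 4 skew inner product has weight `z^{a+1} e^{-z}` on `(0,∞)`. -/
theorem statement9 (a : ℝ) (ha : -1 < a)
    (p : ℤ → Polynomial ℝ) (hpneg : p (-1) = 0)
    (hmonic : ∀ n : ℕ, (p n).Monic) (hdeg : ∀ n : ℕ, (p n).natDegree = n)
    (horth : ∀ n m : ℕ, n ≠ m →
      ∫ z in Set.Ioi (0 : ℝ), (p n).eval z * (p m).eval z * z ^ a * Real.exp (-z) = 0) :
    ∀ m n : ℕ,
      (1 / 2 : ℝ) * ∫ z in Set.Ioi (0 : ℝ),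
          ((p (2 * m)).eval z * (Polynomial.derivative (p (2 * n + 1))).eval z
            - (Polynomial.derivative (p (2 * m))).eval z * (p (2 * n + 1)).eval z)
          * z ^ (a + 1) * Real.exp (-z)
        = (if n = m then
            (1 / 2 : ℝ) * Real.Gamma (2 * (n : ℝ) + 2) * Real.Gamma (2 * (n : ℝ) + a + 2)
          else 0)
          - (if (m : ℤ) - 1 = (n : ℤ) then
            (1 / 2 : ℝ) * Real.Gamma (2 * (m : ℝ) + 1) * Real.Gamma (2 * (m : ℝ) + a + 1)
          else 0) := by
  intro m n
  set P : ℕ → ℝ[X] := fun k => p k with hP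
  have hmonicP : ∀ k, (P k).Monic := hmonic
  have hdegP : ∀ k, (P k).natDegree = k := hdeg
  have horthP : ∀ k l, k ≠ l → laguerreFunctional a (P k * P l) = 0 := by
    intro k l hkl
    rw [← (integrableOn_and_integral_eq_laguerreFunctional ha _).2]
    simpa only [eval_mul] using horth k l hkl
  have heven : p (2 * m) = P (2 * m) := by simp [hP]
  have hodd : p (2 * n + 1) = P (2 * n + 1) := by simp [hP]
  have hint : ∫ z in Set.Ioi (0 : ℝ),
      ((p (2 * m)).eval z * (derivative (p (2 * n + 1))).eval z
        - (derivative (p (2 * m))).eval z * (p (2 * n + 1)).eval z)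
          * z ^ (a + 1) * Real.exp (-z) =
      laguerreFunctional a (P (2 * m) * (X * derivative (P (2 * n + 1))))
        - laguerreFunctional a (P (2 * n + 1) * (X * derivative (P (2 * m)))) := by
    rw [heven, hodd, ← map_sub, ← (integrableOn_and_integral_eq_laguerreFunctional ha _).2]
    refine setIntegral_congr_fun measurableSet_Ioi fun z hz => ?_
    have hz' : 0 < z := hz
    simp only [eval_sub, eval_mul, eval_X]
    rw [Real.rpow_add_one hz'.ne']
    ring
  rw [hint]
  rcases le_or_gt m n with hmn | hmn
  · rw [laguerreFunctional_mul_X_mul_derivative_of_lt ha hmonicP hdegP horthP (by omega),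
      laguerreFunctional_mul_X_mul_derivative_eq_zero hmonicP hdegP horthP (by omega),
      (laguerre_norm_and_coeff ha hmonicP hdegP horthP (2 * n + 1)).1,
      if_neg (show ¬ (m : ℤ) - 1 = n by omega)]
    by_cases h : n = m
    · rw [if_pos h, if_pos (by omega)]
      push_cast
      ring_nf
    · rw [if_neg h, if_neg (by omega)]
      ring
  · rw [laguerreFunctional_mul_X_mul_derivative_eq_zero hmonicP hdegP horthP (by omega),
      laguerreFunctional_mul_X_mul_derivative_of_lt ha hmonicP hdegP horthP (by omega),
      (laguerre_norm_and_coeff ha hmonicP hdegP horthP (2 * m)).1,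
      if_neg (show ¬ n = m by omega)]
    by_cases h : (m : ℤ) - 1 = n
    · rw [if_pos h, if_pos (by omega)]
      push_cast
      ring
    · rw [if_neg h, if_neg (by omega)]
      ring
end
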